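/- Let S be a set of rational primes. If S is finite, then the limit lim_{X→∞} Σ_{2 ≤ n ≤ X, p_min(n) ∈ S} μ(n)/n exists and equals 0; if the complement of S in the set of all primes is finite, then this limit exists and equals −1. -/

import Mathlib

open Filter ArithmeticFunction

noncomputable section

namespace AlladiGen

section Taub
open MeasureTheory Complex FourierTransform SchwartzMap Topology

lemma integrable_damped (h : ℝ → ℂ) (hm : Measurable h) (hb : ∀ t, ‖h t‖ ≤ 2)
    (h0 : ∀ t < 0, h t = 0) (σ : ℝ) (hσ : 0 < σ) :
    Integrable (fun t : ℝ => h t * cexp (-(σ : ℂ) * t)) := by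
  have h1 : Integrable (Set.indicator (Set.Ici (0:ℝ)) (fun t : ℝ => 2 * Real.exp (-σ * t))) := by
    rw [integrable_indicator_iff measurableSet_Ici, integrableOn_Ici_iff_integrableOn_Ioi]
    exact (integrableOn_exp_mul_Ioi (by linarith) 0).const_mul 2
  refine h1.mono' (by fun_prop) (Eventually.of_forall fun t => ?_)
  by_cases ht : t < 0
  · simp [h0 t ht, ht]
  · rw [Set.indicator_of_mem (by simpa using ht)]
    rw [norm_mul, norm_exp]
    gcongr
    · exact hb t
    · simp

lemma step_A (k : 𝓢(ℝ, ℂ)) (h : ℝ → ℂ) (hm : Measurable h) (hb : ∀ t, ‖h t‖ ≤ 2)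
    (h0 : ∀ t < 0, h t = 0) (H : ℂ → ℂ)
    (hH : ∀ s : ℂ, 0 < s.re → ∫ t : ℝ, h t * cexp (-s * t) = H s) (σ : ℝ) (hσ : 0 < σ) (x : ℝ) :
    ∫ u : ℝ, 𝓕 k u * (h (x - u) * cexp (-(σ : ℂ) * ((x - u : ℝ) : ℂ))) =
      𝓕 (fun ξ : ℝ => k ξ * H (σ - 2 * Real.pi * I * ξ)) x := by
  have hi := (integrable_damped h hm hb h0 σ hσ).comp_sub_left x
  have flip := VectorFourier.integral_fourierIntegral_smul_eq_flip (L := innerₗ ℝ) (μ := volume)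
    (ν := volume) Real.continuous_fourierChar continuous_inner k.integrable hi
  have e1 : ∀ u, (𝓕 k) u = VectorFourier.fourierIntegral Real.fourierChar volume (innerₗ ℝ) k u := by
    intro u; rw [SchwartzMap.fourier_coe]; rfl
  simp_rw [e1]
  simp_rw [smul_eq_mul] at flip
  rw [flip, Real.fourier_real_eq_integral_exp_smul]
  congr 1
  ext ξ
  rw [VectorFourier.fourierIntegral, smul_eq_mul]
  rw [← integral_sub_left_eq_self _ volume x, mul_left_comm]
  congr 1
  rw [← hH _ (by simpa using hσ), ← integral_const_mul]
  congr 1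
  ext t
  simp only [Circle.smul_def, Real.fourierChar_apply, smul_eq_mul, sub_sub_cancel]
  rw [mul_left_comm, mul_left_comm (cexp _) (h t), ← Complex.exp_add, ← Complex.exp_add]
  congr 2
  simp
  ring

lemma taub (k : 𝓢(ℝ, ℂ)) (hk : HasCompactSupport k) (h : ℝ → ℂ) (hm : Measurable h)
    (hb : ∀ t, ‖h t‖ ≤ 2)
    (h0 : ∀ t < 0, h t = 0) (H : ℂ → ℂ) (hc : ContinuousOn H {s | 0 ≤ s.re})
    (hH : ∀ s : ℂ, 0 < s.re → ∫ t : ℝ, h t * cexp (-s * t) = H s) :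
    Tendsto (fun x : ℝ => ∫ u : ℝ, 𝓕 k u * h (x - u)) atTop (𝓝 0) := by
  have key : ∀ x : ℝ, ∫ u : ℝ, 𝓕 k u * h (x - u) =
      𝓕 (fun ξ : ℝ => k ξ * H (((0:ℝ):ℂ) - 2 * Real.pi * I * ξ)) x := by
    intro x
    have l1 : Tendsto (fun σ : ℝ => ∫ u : ℝ, 𝓕 k u * (h (x - u) * cexp (-(σ : ℂ) * ((x - u : ℝ) : ℂ))))
        (𝓝[>] 0) (𝓝 (∫ u : ℝ, 𝓕 k u * h (x - u))) := by
      apply tendsto_integral_filter_of_dominated_convergence (fun u => ‖𝓕 k u‖ * 2)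
      · refine Eventually.of_forall fun σ => ?_
        have := (𝓕 k).continuous.measurable
        exact (by fun_prop : Measurable _).aestronglyMeasurable
      · filter_upwards [self_mem_nhdsWithin] with σ hσ
        refine Eventually.of_forall fun u => ?_
        rw [norm_mul]
        gcongr
        by_cases ht : x - u < 0
        · simp [h0 _ ht]
        · rw [norm_mul, norm_exp]
          have : Real.exp (-(σ : ℂ) * ((x - u : ℝ) : ℂ)).re ≤ 1 := by
            rw [Real.exp_le_one_iff]
            have : 0 ≤ σ * (x - u) := mul_nonneg (le_of_lt hσ) (by linarith)
            rw [← ofReal_neg, ← ofReal_mul, ofReal_re]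
            linarith
          have := mul_le_mul (hb (x - u)) this (Real.exp_pos _).le (by norm_num)
          linarith
      · exact (𝓕 k).integrable.norm.mul_const 2
      · refine Eventually.of_forall fun u => ?_
        have : Tendsto (fun σ : ℝ => 𝓕 k u * (h (x - u) * cexp (-(σ : ℂ) * ((x - u : ℝ) : ℂ)))) (𝓝 0)
            (𝓝 (𝓕 k u * (h (x - u) * cexp (-((0:ℝ) : ℂ) * ((x - u : ℝ) : ℂ))))) := by
          apply Continuous.tendsto; fun_prop
        simpa using this.mono_left nhdsWithin_le_nhds
    have l2 : Tendsto (fun σ : ℝ => 𝓕 (fun ξ : ℝ => k ξ * H (σ - 2 * Real.pi * I * ξ)) x)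
        (𝓝[>] 0) (𝓝 (𝓕 (fun ξ : ℝ => k ξ * H (((0:ℝ):ℂ) - 2 * Real.pi * I * ξ)) x)) := by
      have hcomp : IsCompact ((fun p : ℝ × ℝ => ((p.1 : ℂ) - 2 * Real.pi * I * p.2)) ''
          (Set.Icc 0 1 ×ˢ tsupport k)) :=
        (isCompact_Icc.prod hk.isCompact).image (by fun_prop)
      obtain ⟨C, hC⟩ := hcomp.exists_bound_of_continuousOn (f := H) (hc.mono (by
        rintro _ ⟨⟨a, b⟩, ⟨ha, -⟩, rfl⟩
        simpa using ha.1))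
      have cH : ∀ σ : ℝ, 0 ≤ σ → Continuous (fun ξ : ℝ => H (σ - 2 * Real.pi * I * ξ)) := by
        intro σ hσ
        exact hc.comp_continuous (by fun_prop) (fun ξ => by simpa using hσ)
      simp_rw [Real.fourier_real_eq_integral_exp_smul]
      apply tendsto_integral_filter_of_dominated_convergence (fun u => ‖k u‖ * C)
      · filter_upwards [self_mem_nhdsWithin] with σ hσ
        refine Continuous.aestronglyMeasurable ?_
        have c1 : Continuous (fun v : ℝ => cexp (↑(-2 * Real.pi * v * x) * I)) := by fun_prop
        exact c1.smul (k.continuous.mul (cH σ (le_of_lt hσ)))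
      · filter_upwards [Ioo_mem_nhdsGT (zero_lt_one' ℝ)] with σ hσ
        refine Eventually.of_forall fun ξ => ?_
        rw [norm_smul, norm_exp_ofReal_mul_I, one_mul, norm_mul]
        by_cases hξ : ξ ∈ tsupport k
        · gcongr
          exact hC _ ⟨(σ, ξ), ⟨⟨hσ.1.le, hσ.2.le⟩, hξ⟩, rfl⟩
        · simp [image_eq_zero_of_notMem_tsupport hξ]
      · exact k.integrable.norm.mul_const C
      · refine Eventually.of_forall fun ξ => ?_
        refine Tendsto.const_smul (Tendsto.const_mul _ ?_) _
        have : ContinuousWithinAt (fun σ : ℝ => H (σ - 2 * Real.pi * I * ξ)) (Set.Ici 0) 0 := by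
          have : ContinuousOn (fun σ : ℝ => H (σ - 2 * Real.pi * I * ξ)) (Set.Ici 0) :=
            hc.comp (by fun_prop) (fun σ hσ => by simpa using hσ)
          exact this 0 (by simp)
        exact this.tendsto.mono_left (nhdsWithin_mono _ Set.Ioi_subset_Ici_self)
    refine tendsto_nhds_unique l1 (l2.congr' ?_)
    filter_upwards [self_mem_nhdsWithin] with σ hσ
    exact (step_A k h hm hb h0 H hH σ hσ x).symm
  simp_rw [key]
  exact (Real.zero_at_infty_fourier _).mono_left atTop_le_cocompact

lemma exists_kernel : ∃ k : 𝓢(ℝ, ℂ), HasCompactSupport k ∧ ∫ u, 𝓕 k u = 1 := by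
  let b : ContDiffBump (0:ℝ) := ⟨1, 2, by norm_num, by norm_num⟩
  have h1 : HasCompactSupport (fun x => ((b x : ℝ) : ℂ)) :=
    b.hasCompactSupport.comp_left (g := fun x : ℝ => (x : ℂ)) (by simp)
  have h2 : ContDiff ℝ (⊤ : ℕ∞) (fun x => ((b x : ℝ) : ℂ)) :=
    Complex.ofRealCLM.contDiff.comp b.contDiff
  refine ⟨h1.toSchwartzMap h2, h1, ?_⟩
  set k := h1.toSchwartzMap h2
  have : 𝓕⁻ (𝓕 k) 0 = k 0 := by rw [FourierTransform.fourierInv_fourier_eq]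
  rw [SchwartzMap.fourierInv_coe, Real.fourierInv_eq'] at this
  simp at this
  rw [this]
  change ((b 0 : ℝ) : ℂ) = 1
  rw [b.one_of_mem_closedBall (by simp [b])]
  simp

/-- Tauberian theorem for slowly varying bounded functions. -/
lemma taub_main (g : ℝ → ℂ) (hm : Measurable g) (hb : ∀ t, ‖g t‖ ≤ 2)
    (h0 : ∀ t < 0, g t = 0) (H : ℂ → ℂ) (hc : ContinuousOn H {s | 0 ≤ s.re})
    (hH : ∀ s : ℂ, 0 < s.re → ∫ t : ℝ, g t * cexp (-s * t) = H s)
    (hslow : ∀ x y : ℝ, 1 ≤ x → ‖g x - g y‖ ≤ 4 * |x - y| + Real.exp (1 - x)) :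
    Tendsto g atTop (𝓝 0) := by
  obtain ⟨k, hk, hK⟩ := exists_kernel
  set A := ∫ u, |u| * ‖𝓕 k u‖ with hA
  set B := ∫ u, ‖𝓕 k u‖ with hB
  have iA : Integrable (fun u : ℝ => |u| * ‖𝓕 k u‖) := by
    refine ((𝓕 k).integrable_pow_mul volume 1).congr (Eventually.of_forall fun u => ?_)
    simp only [pow_one, Real.norm_eq_abs]
  have iB : Integrable (fun u : ℝ => ‖𝓕 k u‖) := (𝓕 k).integrable.norm
  have A0 : 0 ≤ A := integral_nonneg fun u => by positivity
  rw [Metric.tendsto_atTop']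
  intro ε hε
  -- the scale
  set l : ℝ := (12 * (A + 1)) / ε with hl
  have lpos : 0 < l := by positivity
  have hT := taub k hk (fun y => g (y / l)) (by fun_prop) (fun t => hb _)
    (fun t ht => h0 _ (div_neg_of_neg_of_pos ht lpos)) (fun s => l * H (l * s))
    (by
      refine continuousOn_const.mul (hc.comp (by fun_prop) ?_)
      intro s hs
      have : 0 ≤ l * s.re := mul_nonneg lpos.le hs
      simpa using this)
    (by
      intro s hs
      rw [← hH _ (by simpa using mul_pos lpos hs)]
      have := Measure.integral_comp_div (fun t : ℝ => g t * cexp (-(l * s) * t)) l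
      rw [abs_of_pos lpos] at this
      rw [← real_smul, ← this]
      congr 1
      ext t
      congr 2
      have : (l : ℂ) ≠ 0 := by exact_mod_cast lpos.ne'
      push_cast
      field_simp)
  have e1 : ∀ᶠ x in atTop, ‖∫ u : ℝ, 𝓕 k u * g ((l * x - u) / l)‖ < ε / 3 := by
    have := hT.comp (tendsto_id.const_mul_atTop lpos)
    have := this.norm
    simp only [norm_zero] at this
    exact this.eventually (gt_mem_nhds (by positivity))
  have e2 : ∀ᶠ x : ℝ in atTop, Real.exp (1 - x) * B < ε / 3 := by
    have : Tendsto (fun x : ℝ => Real.exp (1 - x) * B) atTop (𝓝 (0 * B)) := by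
      refine Tendsto.mul_const _ (Real.tendsto_exp_atBot.comp ?_)
      exact tendsto_atBot_add_const_left atTop 1 tendsto_neg_atTop_atBot
    rw [zero_mul] at this
    exact this.eventually (gt_mem_nhds (by positivity))
  obtain ⟨N, hN⟩ := (e1.and (e2.and (eventually_ge_atTop 1))).exists_forall_of_atTop
  refine ⟨N, fun x hx => ?_⟩
  obtain ⟨h1, h2, h3⟩ := hN x hx.le
  rw [dist_zero_right]
  have iK : Integrable (fun u => 𝓕 k u * g x) := (𝓕 k).integrable.mul_const _
  have iK2 : Integrable (fun u => 𝓕 k u * g ((l * x - u) / l)) := by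
    refine (iB.mul_const 2).mono' ?_ (Eventually.of_forall fun u => ?_)
    · have := (𝓕 k).continuous.measurable
      exact (by fun_prop : Measurable _).aestronglyMeasurable
    · rw [norm_mul]; gcongr; exact hb _
  have d : g x = (∫ u, 𝓕 k u * (g x - g ((l * x - u) / l))) + ∫ u, 𝓕 k u * g ((l * x - u) / l) := by
    simp_rw [mul_sub]
    rw [integral_sub iK iK2, integral_mul_const, hK]
    ring
  have b1 : ‖∫ u, 𝓕 k u * (g x - g ((l * x - u) / l))‖ ≤ 4 / l * A + Real.exp (1 - x) * B := by
    rw [hA, hB, ← integral_const_mul, ← integral_const_mul, ← integral_add (iA.const_mul _) (iB.const_mul _)]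
    refine norm_integral_le_of_norm_le ((iA.const_mul _).add (iB.const_mul _))
      (Eventually.of_forall fun u => ?_)
    rw [norm_mul]
    have := hslow x ((l * x - u) / l) h3
    have e : x - (l * x - u) / l = u / l := by field_simp; ring
    rw [e, abs_div, abs_of_pos lpos] at this
    calc _ ≤ ‖𝓕 k u‖ * (4 * (|u| / l) + Real.exp (1 - x)) := by gcongr
      _ = _ := by ring
  have b2 : 4 / l * A < ε / 3 := by
    rw [hl]
    have : 4 / (12 * (A + 1) / ε) * A = ε / 3 * (A / (A + 1)) := by field_simp; ring
    rw [this]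
    have : A / (A + 1) < 1 := by rw [div_lt_one (by positivity)]; linarith
    have : ε / 3 * (A / (A + 1)) < ε / 3 * 1 := mul_lt_mul_of_pos_left this (by positivity)
    linarith
  have := norm_add_le (∫ u, 𝓕 k u * (g x - g ((l * x - u) / l))) (∫ u, 𝓕 k u * g ((l * x - u) / l))
  rw [← d] at this
  linarith
end Taub

section Elem
open Finset

/-- partial sums of `μ(n)/n`. -/
def M (X : ℕ) : ℝ := ∑ n ∈ Icc 1 X, (moebius n : ℝ) / (n : ℝ)

lemma abs_M_le (X : ℕ) : |M X| ≤ 2 := by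
  rcases Nat.eq_zero_or_pos X with rfl | hX
  · simp [M]
  have h1 : ∑ n ∈ Ioc 0 X, (moebius n : ℝ) * ((X / n : ℕ) : ℝ) = 1 := by
    have := sum_Ioc_mul_zeta_eq_sum (moebius : ArithmeticFunction ℤ) X
    rw [show (moebius * (zeta : ArithmeticFunction ℤ)) = 1 from moebius_mul_coe_zeta] at this
    have h2 : ∑ n ∈ Ioc 0 X, (1 : ArithmeticFunction ℤ) n = 1 := by
      rw [sum_eq_single 1]
      · simp
      · intro b _ hb; simp [one_apply, hb]
      · intro h; simp at h; omega
    rw [h2] at this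
    have this2 : ∑ n ∈ Ioc 0 X, moebius n * ((X / n : ℕ) : ℤ) = 1 := this.symm
    have := congrArg (Int.cast : ℤ → ℝ) this2
    rw [Int.cast_sum] at this
    simp only [Int.cast_mul, Int.cast_natCast, Int.cast_one] at this
    exact this
  have h2 : (X : ℝ) * M X = 1 + ∑ n ∈ Ioc 0 X, (moebius n : ℝ) * ((X : ℝ) / n - ((X / n : ℕ) : ℝ)) := by
    simp_rw [mul_sub]
    rw [sum_sub_distrib, h1, M, mul_sum]
    have : Icc 1 X = Ioc 0 X := by ext; simp [Nat.succ_le_iff]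
    rw [this]
    have : ∀ n ∈ Ioc 0 X, (X : ℝ) * ((moebius n : ℝ) / n) = (moebius n : ℝ) * ((X : ℝ) / n) := by
      intro n _; ring
    rw [sum_congr rfl this]
    ring
  have h3 : |∑ n ∈ Ioc 0 X, (moebius n : ℝ) * ((X : ℝ) / n - ((X / n : ℕ) : ℝ))| ≤ X := by
    refine (abs_sum_le_sum_abs _ _).trans ?_
    calc _ ≤ ∑ n ∈ Ioc 0 X, (1 : ℝ) := by
          refine sum_le_sum fun n hn => ?_
          rw [abs_mul]
          have a : |(moebius n : ℝ)| ≤ 1 := by exact_mod_cast abs_moebius_le_one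
          have b : |(X : ℝ) / n - ((X / n : ℕ) : ℝ)| ≤ 1 := by
            rw [← Nat.floor_div_eq_div (K := ℝ), abs_le]
            have := Nat.floor_le (show 0 ≤ (X : ℝ) / n by positivity)
            have := Nat.lt_floor_add_one ((X : ℝ) / n)
            constructor <;> linarith
          calc _ ≤ (1:ℝ) * 1 := by gcongr
            _ = 1 := by norm_num
      _ = X := by simp
  have hX' : (1:ℝ) ≤ X := by exact_mod_cast hX
  have h4 : (X : ℝ) * |M X| ≤ X * 2 := by
    rw [← abs_of_pos (show (0:ℝ) < X by linarith), ← abs_mul, h2, abs_of_pos (show (0:ℝ) < X by linarith)]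
    refine (abs_add_le _ _).trans ?_
    rw [abs_one]; linarith
  exact le_of_mul_le_mul_left h4 (by linarith)

lemma sum_inv_le (a b : ℕ) (ha : 1 ≤ a) (hab : a ≤ b) :
    ∑ n ∈ Ioc a b, (1 : ℝ) / n ≤ Real.log b - Real.log a := by
  induction b, hab using Nat.le_induction with
  | base => simp
  | succ b hb ih =>
    rw [Finset.sum_Ioc_succ_top (by omega)]
    have hb0 : (0:ℝ) < b := by exact_mod_cast (by omega)
    have := Real.log_le_sub_one_of_pos (show (0:ℝ) < b / (b+1) by positivity)
    rw [Real.log_div (by positivity) (by positivity)] at this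
    have e : (b : ℝ) / (b + 1) - 1 = - (1 / (b + 1)) := by field_simp; ring
    rw [e] at this
    push_cast
    linarith

lemma M_sub (a b : ℕ) (hab : a ≤ b) : |M b - M a| ≤ ∑ n ∈ Ioc a b, (1 : ℝ) / n := by
  have : M b - M a = ∑ n ∈ Ioc a b, (moebius n : ℝ) / n := by
    have e : ∀ X, Icc 1 X = Ioc 0 X := by intro X; ext; simp [Nat.succ_le_iff]
    simp only [M, e]
    rw [← sum_Ioc_consecutive _ (Nat.zero_le a) hab]; ring
  rw [this]
  refine (abs_sum_le_sum_abs _ _).trans (sum_le_sum fun n hn => ?_)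
  rw [abs_div, Nat.abs_cast]
  gcongr
  exact_mod_cast abs_moebius_le_one

lemma M_slow_aux (x y : ℝ) (hxy : x ≤ y) :
    |M ⌊Real.exp y⌋₊ - M ⌊Real.exp x⌋₊| ≤ (y - x) + Real.exp (-x) := by
  set a := ⌊Real.exp x⌋₊ with ha
  set b := ⌊Real.exp y⌋₊ with hb
  have hab : a ≤ b := Nat.floor_mono (Real.exp_le_exp.2 hxy)
  have e1 : Real.exp x < a + 1 := Nat.lt_floor_add_one _
  have e2 : (b : ℝ) ≤ Real.exp y := Nat.floor_le (Real.exp_pos y).le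
  refine (M_sub a b hab).trans ?_
  rcases hab.eq_or_lt with h | h
  · rw [h]; simp; have := Real.exp_pos (-x); linarith
  · rw [← sum_Ioc_consecutive _ (Nat.le_succ a) h]
    have s := sum_inv_le (a+1) b (by omega) h
    have l1 : Real.log b ≤ y := by
      rw [← Real.log_exp y]
      apply Real.log_le_log _ e2
      exact_mod_cast (by omega)
    have l2 : x ≤ Real.log ((a + 1 : ℕ) : ℝ) := by
      rw [Real.le_log_iff_exp_le (by positivity)]
      push_cast; exact e1.le
    have l3 : ∑ n ∈ Ioc a a.succ, (1 : ℝ) / n ≤ Real.exp (-x) := by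
      rw [Nat.Ioc_succ_singleton, sum_singleton, Real.exp_neg, one_div]
      push_cast
      exact inv_anti₀ (Real.exp_pos x) e1.le
    simp only [Nat.succ_eq_add_one] at *
    linarith

lemma M_slow (x y : ℝ) (hx : 1 ≤ x) :
    |M ⌊Real.exp x⌋₊ - M ⌊Real.exp y⌋₊| ≤ 4 * |x - y| + Real.exp (1 - x) := by
  have p := Real.exp_pos (1 - x)
  have q := abs_nonneg (x - y)
  by_cases h : 1 ≤ |x - y|
  · have h1 := abs_M_le ⌊Real.exp x⌋₊
    have h2 := abs_M_le ⌊Real.exp y⌋₊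
    have := abs_sub (M ⌊Real.exp x⌋₊) (M ⌊Real.exp y⌋₊)
    linarith
  · push Not at h
    rcases le_total x y with hxy | hxy
    · rw [abs_sub_comm]
      have := M_slow_aux x y hxy
      have e : Real.exp (-x) ≤ Real.exp (1 - x) := Real.exp_le_exp.2 (by linarith)
      have : |x - y| = y - x := by rw [abs_of_nonpos (by linarith)]; ring
      linarith
    · have t : |x - y| = x - y := by rw [abs_of_nonneg (by linarith)]
      rw [t] at h
      have := M_slow_aux y x hxy
      have e : Real.exp (-y) ≤ Real.exp (1 - x) := Real.exp_le_exp.2 (by linarith)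
      linarith

end Elem

section Zeta
open Complex MeasureTheory Topology

def G (t : ℝ) : ℂ := ((M ⌊Real.exp t⌋₊ : ℝ) : ℂ)

def Zt (s : ℂ) : ℂ := Function.update (fun s => s * riemannZeta (1 + s)) 0 1 s

lemma Zt_cont : ContinuousOn (fun s => (Zt s)⁻¹) {s | 0 ≤ s.re} := by
  apply ContinuousOn.inv₀
  · apply Continuous.continuousOn
    rw [continuous_iff_continuousAt]
    intro s
    by_cases hs : s = 0
    · subst hs
      unfold Zt
      rw [continuousAt_update_same]
      have : Tendsto (fun s : ℂ => 1 + s) (𝓝[≠] 0) (𝓝[≠] 1) := by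
        refine tendsto_nhdsWithin_iff.2 ⟨?_, ?_⟩
        · have : Tendsto (fun s : ℂ => 1 + s) (𝓝 0) (𝓝 (1 + 0)) := by
            apply Continuous.tendsto; fun_prop
          rw [add_zero] at this
          exact this.mono_left nhdsWithin_le_nhds
        · filter_upwards [self_mem_nhdsWithin] with s hs
          simpa using hs
      simpa [Function.comp_def] using riemannZeta_residue_one.comp this
    · unfold Zt
      rw [continuousAt_update_of_ne hs]
      have : ContinuousAt riemannZeta (1 + s) :=
        (differentiableAt_riemannZeta (by simpa using hs)).continuousAt
      exact continuousAt_id.mul (this.comp' (by fun_prop))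
  · intro s hs
    by_cases h : s = 0
    · simp [Zt, h]
    · simp only [Zt, Function.update_of_ne h]
      exact mul_ne_zero h (riemannZeta_ne_zero_of_one_le_re (by simpa using hs))

lemma G_laplace (s : ℂ) (hs : 0 < s.re) : ∫ t : ℝ, G t * cexp (-s * t) = (Zt s)⁻¹ := by
  have hs0 : s ≠ 0 := by rintro rfl; simp at hs
  have hs1 : 1 < (1 + s).re := by simpa using hs
  have hz := LSeries_zeta_mul_Lseries_moebius hs1
  rw [LSeries_zeta_eq_riemannZeta hs1] at hz
  have term : ∀ n, LSeries.term (fun n => ((moebius n : ℝ) / (n : ℝ) : ℂ)) s n =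
      LSeries.term (fun n => ((moebius n : ℤ) : ℂ)) (1 + s) n := by
    intro n
    rcases Nat.eq_zero_or_pos n with rfl | hn
    · simp
    · have : (n : ℂ) ≠ 0 := by exact_mod_cast hn.ne'
      rw [LSeries.term_of_ne_zero hn.ne', LSeries.term_of_ne_zero hn.ne', cpow_add _ _ this, cpow_one]
      simp [div_div]
  have term' := funext term
  have hS : LSeriesSummable (fun n => ((moebius n : ℝ) / (n : ℝ) : ℂ)) s := by
    unfold LSeriesSummable
    rw [term']
    exact LSeriesSummable_moebius_iff.2 hs1
  have hM : ∀ n, ∑ k ∈ Finset.Icc 1 n, ((moebius k : ℝ) / (k : ℝ) : ℂ) = ((M n : ℝ) : ℂ) := by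
    intro n; simp [M]
  have hI := LSeries_eq_mul_integral (fun n => ((moebius n : ℝ) / (n : ℝ) : ℂ)) le_rfl hs hS (by
    simp_rw [hM]
    refine Asymptotics.IsBigO.of_bound 2 (Eventually.of_forall fun n => ?_)
    simpa using abs_M_le n)
  simp_rw [hM] at hI
  have hL : LSeries (fun n => ((moebius n : ℝ) / (n : ℝ) : ℂ)) s =
      LSeries (fun n => ((moebius n : ℤ) : ℂ)) (1 + s) := by
    unfold LSeries; rw [term']
  rw [hL] at hI
  have hsub := integral_comp_exp_Ioi (fun t : ℝ => ((M ⌊t⌋₊ : ℝ) : ℂ) * (t : ℂ) ^ (-(s + 1))) 0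
  rw [Real.exp_zero] at hsub
  rw [← hsub] at hI
  have hG : ∫ t : ℝ, G t * cexp (-s * t) = ∫ t in Set.Ioi (0:ℝ), Real.exp t •
      (((M ⌊Real.exp t⌋₊ : ℝ) : ℂ) * (Real.exp t : ℂ) ^ (-(s + 1))) := by
    have : ∫ t : ℝ, G t * cexp (-s * t) = ∫ t in Set.Ici (0:ℝ), G t * cexp (-s * t) := by
      symm
      apply setIntegral_eq_integral_of_forall_compl_eq_zero
      intro t ht
      have : Real.exp t < 1 := by simpa using ht
      simp [G, Nat.floor_eq_zero.2 this, M]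
    rw [this, integral_Ici_eq_integral_Ioi]
    congr 1
    ext t
    rw [Complex.real_smul, mul_left_comm, G]
    congr 1
    rw [ofReal_exp, ← Complex.exp_log (x := cexp (t:ℂ)) (by simp), ← ofReal_exp, ← ofReal_log (Real.exp_pos t).le, Real.log_exp]
    rw [cpow_def_of_ne_zero (by simp), ← ofReal_exp, ← ofReal_log (Real.exp_pos t).le, Real.log_exp, ofReal_exp, ← Complex.exp_add]
    congr 1
    ring
  rw [hG]
  simp only [Zt, Function.update_of_ne hs0]
  rw [hI] at hz
  apply eq_inv_of_mul_eq_one_right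
  rw [mul_assoc, mul_left_comm]
  exact hz

end Zeta

section Conclude
open Topology
lemma M_tendsto : Tendsto M atTop (nhds 0) := by
  have h := taub_main G (by
      unfold G
      have h1 : Measurable (fun n : ℕ => ((M n : ℝ) : ℂ)) := measurable_from_top
      exact h1.comp (Nat.measurable_floor.comp Real.measurable_exp))
    (fun t => by simpa [G] using abs_M_le _)
    (fun t ht => by
      have : Real.exp t < 1 := by simpa using ht
      simp [G, Nat.floor_eq_zero.2 this, M])
    _ Zt_cont G_laplace (fun x y hx => by
      have := M_slow x y hx
      simp only [G]
      rw [← Complex.ofReal_sub, Complex.norm_real, Real.norm_eq_abs]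
      exact this)
  have h2 := h.comp (Real.tendsto_log_atTop.comp tendsto_natCast_atTop_atTop)
  have h3 : Tendsto (fun n : ℕ => ((M n : ℝ) : ℂ)) atTop (nhds ((0 : ℝ) : ℂ)) := by
    rw [Complex.ofReal_zero]
    refine h2.congr' ?_
    filter_upwards [eventually_ge_atTop 1] with n hn
    have : (0:ℝ) < n := by exact_mod_cast hn
    simp [G, Real.exp_log this]
  exact Filter.tendsto_ofReal_iff.1 h3
end Conclude

section Sieve
open Finset

lemma seq_lemma (b c : ℕ → ℝ) (p : ℕ) (hp : 2 ≤ p) (hc : Tendsto c atTop (nhds 0))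
    (h : ∀ X, b X = c X + (1 / (p : ℝ)) * b (X / p)) : Tendsto b atTop (nhds 0) := by
  have hr : ∀ x : ℝ, |(1 / (p : ℝ)) * x| ≤ |x| / 2 := by
    intro x
    have hp' : (2 : ℝ) ≤ p := by exact_mod_cast hp
    rw [abs_mul, abs_of_pos (show (0:ℝ) < 1 / p by positivity), div_eq_inv_mul |x|, one_div]
    gcongr
  obtain ⟨C, hC⟩ := hc.abs.bddAbove_range
  have hC' : ∀ X, |c X| ≤ C := fun X => hC ⟨X, rfl⟩
  have hb : ∀ X, |b X| ≤ 2 * C := by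
    intro X
    induction X using Nat.strong_induction_on with
    | _ X ih =>
      have e := h X
      have h1 := abs_add_le (c X) ((1 / (p : ℝ)) * b (X / p))
      rw [← e] at h1
      have h2 := hr (b (X / p))
      have h3 := hC' X
      rcases Nat.eq_zero_or_pos X with rfl | hX
      · simp only [Nat.zero_div] at h1 h2
        linarith
      · have := ih (X / p) (Nat.div_lt_self hX (by omega))
        linarith
  have hdiv : Tendsto (fun X : ℕ => X / p) atTop atTop :=
    Nat.tendsto_div_const_atTop (by omega)
  have it : ∀ ε > 0, ∀ k : ℕ, ∀ᶠ X in atTop, |b X| ≤ 2 * C / 2 ^ k + 2 * ε := by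
    intro ε hε k
    induction k with
    | zero => exact Eventually.of_forall fun X => by have := hb X; simp; linarith
    | succ k ih =>
      have hc' : ∀ᶠ X in atTop, |c X| < ε := by
        have := hc.abs; rw [abs_zero] at this
        exact this.eventually (gt_mem_nhds hε)
      filter_upwards [hdiv.eventually ih, hc'] with X h1 h2
      have e := h X
      have h3 := abs_add_le (c X) ((1 / (p : ℝ)) * b (X / p))
      rw [← e] at h3
      have h4 := hr (b (X / p))
      have : 2 * C / 2 ^ (k+1) = (2 * C / 2 ^ k) / 2 := by rw [pow_succ]; field_simp
      rw [this]
      linarith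
  rw [Metric.tendsto_atTop']
  intro ε hε
  have hk : Tendsto (fun k : ℕ => 2 * C / (2:ℝ) ^ k) atTop (nhds 0) := by
    apply Tendsto.const_div_atTop
    exact tendsto_pow_atTop_atTop_of_one_lt (by norm_num)
  obtain ⟨k, hk⟩ := (hk.eventually (gt_mem_nhds (half_pos hε))).exists
  obtain ⟨N, hN⟩ := (it (ε / 8) (by positivity) k).exists_forall_of_atTop
  refine ⟨N, fun X hX => ?_⟩
  have := hN X hX.le
  rw [dist_zero_right, Real.norm_eq_abs]
  linarith

open Classical in
/-- sum over `n` with all prime factors at least `y` -/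
def Phi (y X : ℕ) : ℝ :=
  ∑ n ∈ Icc 1 X, if ∀ q, q.Prime → q ∣ n → y ≤ q then (moebius n : ℝ) / (n : ℝ) else 0

open Classical in
/-- sum over `n` with smallest prime factor `p` -/
def Psi (p X : ℕ) : ℝ :=
  ∑ n ∈ Icc 2 X, if n.minFac = p then (moebius n : ℝ) / (n : ℝ) else 0

lemma Phi_zero (X : ℕ) : Phi 0 X = M X := by simp [Phi, M]

lemma Phi_succ_of_not_prime (y X : ℕ) (hy : ¬ y.Prime) : Phi (y + 1) X = Phi y X := by
  unfold Phi
  refine sum_congr rfl fun n _ => ?_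
  congr 1
  apply propext
  refine forall_congr' fun q => forall_congr' fun hq => forall_congr' fun _ => ?_
  constructor
  · intro h; omega
  · intro h
    have : y ≠ q := by rintro rfl; exact hy hq
    omega

lemma Psi_eq (p X : ℕ) : Psi p X = Phi p X - Phi (p + 1) X := by
  unfold Phi Psi
  rw [← sum_sub_distrib]
  have : Icc 2 X ⊆ Icc 1 X := Icc_subset_Icc_left (by norm_num)
  rw [← sum_subset this]
  · refine sum_congr rfl fun n hn => ?_
    have hn2 : 2 ≤ n := (mem_Icc.1 hn).1
    have hmp := Nat.minFac_prime (n := n) (by omega)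
    have hmd := Nat.minFac_dvd n
    have key : ∀ y, (∀ q, q.Prime → q ∣ n → y ≤ q) ↔ y ≤ n.minFac := by
      intro y
      exact ⟨fun h => h _ hmp hmd, fun h q hq hd => h.trans (Nat.minFac_le_of_dvd hq.two_le hd)⟩
    simp only [key]
    rcases lt_trichotomy n.minFac p with h | h | h
    · rw [if_neg (by omega), if_neg (by omega), if_neg (by omega)]; simp
    · rw [if_pos (by omega), if_pos (by omega), if_neg (by omega)]; simp
    · rw [if_neg (by omega), if_pos (by omega), if_pos (by omega)]; simp
  · intro n h1 h2
    have : n = 1 := by simp at h1 h2; omega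
    subst this
    have key : ∀ y, (∀ q : ℕ, q.Prime → q ∣ 1 → y ≤ q) := by
      intro y q hq hd
      exact absurd (Nat.dvd_one.1 hd) hq.one_lt.ne'
    rw [if_pos (key _), if_pos (key _)]; simp

lemma Psi_rec (p X : ℕ) (hp : p.Prime) : Psi p X = - (1 / (p : ℝ)) * Phi (p + 1) (X / p) := by
  unfold Phi Psi
  rw [mul_sum]
  have p0 : (p : ℝ) ≠ 0 := by exact_mod_cast hp.ne_zero
  have inj : Function.Injective (fun m : ℕ => p * m) :=
    fun a b h => Nat.eq_of_mul_eq_mul_left hp.pos h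
  have hi : ∑ n ∈ (Icc 1 (X / p)).map ⟨fun m => p * m, inj⟩,
      (if n.minFac = p then (moebius n : ℝ) / (n : ℝ) else 0) =
      ∑ n ∈ Icc 2 X, (if n.minFac = p then (moebius n : ℝ) / (n : ℝ) else 0) := by
    apply sum_subset
    · intro n hn
      simp only [Finset.mem_map, mem_Icc, Function.Embedding.coeFn_mk] at hn
      obtain ⟨m, ⟨h1, h2⟩, rfl⟩ := hn
      rw [mem_Icc]
      refine ⟨?_, ?_⟩
      · calc 2 ≤ p := hp.two_le
          _ ≤ p * m := Nat.le_mul_of_pos_right _ h1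
      · rw [mul_comm]; exact (Nat.le_div_iff_mul_le hp.pos).1 h2
    · intro n hn hn'
      rw [if_neg]
      intro hm
      apply hn'
      obtain ⟨m, hm'⟩ : p ∣ n := hm ▸ Nat.minFac_dvd n
      rw [mem_Icc] at hn
      simp only [Finset.mem_map, mem_Icc, Function.Embedding.coeFn_mk]
      refine ⟨m, ⟨?_, ?_⟩, hm'.symm⟩
      · rcases Nat.eq_zero_or_pos m with rfl | h
        · simp at hm'; omega
        · exact h
      · rw [Nat.le_div_iff_mul_le hp.pos, mul_comm, ← hm']; exact hn.2
  rw [← hi, sum_map]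
  refine sum_congr rfl fun m hm => ?_
  have hm1 : 1 ≤ m := (mem_Icc.1 hm).1
  simp only [Function.Embedding.coeFn_mk]
  have hmin : (p * m).minFac = p ↔ ∀ q, q.Prime → q ∣ m → p ≤ q := by
    constructor
    · intro h q hq hd
      rw [← h]
      exact Nat.minFac_le_of_dvd hq.two_le (hd.mul_left p)
    · intro h
      have h2 : p * m ≠ 1 := by
        intro h; have := Nat.eq_one_of_mul_eq_one_right h; exact hp.one_lt.ne' this
      apply le_antisymm
      · exact Nat.minFac_le_of_dvd hp.two_le (Nat.dvd_mul_right p m)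
      · have hq := Nat.minFac_prime h2
        rcases hq.dvd_mul.1 (Nat.minFac_dvd (p * m)) with h3 | h3
        · exact ((Nat.prime_dvd_prime_iff_eq hq hp).1 h3).ge
        · exact h _ hq h3
  by_cases hpm : p ∣ m
  · have z : moebius (p * m) = 0 := by
      apply moebius_eq_zero_of_not_squarefree
      intro hsq
      obtain ⟨c, rfl⟩ := hpm
      have := hsq p ⟨c, by ring⟩
      exact hp.prime.not_isUnit this
    have n : ¬ ∀ q, q.Prime → q ∣ m → p + 1 ≤ q := by
      intro h; have := h p hp hpm; omega
    rw [if_neg n, z]; simp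
  · have e : (∀ q, q.Prime → q ∣ m → p + 1 ≤ q) ↔ ∀ q, q.Prime → q ∣ m → p ≤ q := by
      refine forall_congr' fun q => forall_congr' fun hq => forall_congr' fun hd => ?_
      have : p ≠ q := by rintro rfl; exact hpm hd
      omega
    have cop : Nat.Coprime p m := (Nat.Prime.coprime_iff_not_dvd hp).2 hpm
    by_cases hh : ∀ q, q.Prime → q ∣ m → p ≤ q
    · rw [if_pos (hmin.2 hh), if_pos (e.2 hh)]
      rw [isMultiplicative_moebius.map_mul_of_coprime cop, moebius_apply_prime hp]
      push_cast
      field_simp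
    · rw [if_neg (fun h => hh (hmin.1 h)), if_neg (fun h => hh (e.1 h))]
      simp

lemma Phi_tendsto (y : ℕ) : Tendsto (Phi y) atTop (nhds 0) := by
  induction y with
  | zero => rw [show Phi 0 = M from funext Phi_zero]; exact M_tendsto
  | succ y ih =>
    by_cases hy : y.Prime
    · refine seq_lemma _ _ y hy.two_le ih fun X => ?_
      have h1 := Psi_eq y X
      have h2 := Psi_rec y X hy
      linarith
    · rw [show Phi (y + 1) = Phi y from funext fun X => Phi_succ_of_not_prime y X hy]
      exact ih

lemma Psi_tendsto (p : ℕ) (hp : p.Prime) : Tendsto (Psi p) atTop (nhds 0) := by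
  rw [show Psi p = fun X => Phi p X - Phi (p + 1) X from funext fun X => Psi_eq p X]
  simpa using (Phi_tendsto p).sub (Phi_tendsto (p + 1))

open Classical in
lemma finite_case (S : Set ℕ) (hS : ∀ p ∈ S, p.Prime) (hf : S.Finite) :
      Tendsto (fun X : ℕ =>
          ∑ n ∈ Finset.Icc 2 X, if n.minFac ∈ S then (moebius n : ℝ) / (n : ℝ) else 0)
        atTop (nhds 0) := by
  have h : Tendsto (fun X => ∑ p ∈ hf.toFinset, Psi p X) atTop (nhds (∑ p ∈ hf.toFinset, (0:ℝ))) :=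
    tendsto_finsetSum _ fun p hp => Psi_tendsto p (hS p (by simpa using hp))
  rw [sum_const_zero] at h
  refine h.congr fun X => ?_
  unfold Psi
  rw [sum_comm]
  refine sum_congr rfl fun n _ => ?_
  rw [sum_ite_eq]
  simp

end Sieve

open Classical in
/-- The Möbius sum over `n` with smallest prime factor in a finite (resp. cofinite)
set of primes converges to `0` (resp. `-1`). -/
theorem finite_cofinite_cases (S : Set ℕ) (hS : ∀ p ∈ S, p.Prime) :
    (S.Finite →
      Tendsto (fun X : ℕ =>
          ∑ n ∈ Finset.Icc 2 X, if n.minFac ∈ S then (moebius n : ℝ) / (n : ℝ) else 0)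
        atTop (nhds 0)) ∧
    (({p : ℕ | p.Prime} \ S).Finite →
      Tendsto (fun X : ℕ =>
          ∑ n ∈ Finset.Icc 2 X, if n.minFac ∈ S then (moebius n : ℝ) / (n : ℝ) else 0)
        atTop (nhds (-1))) := by
  refine ⟨finite_case S hS, fun hf => ?_⟩
  have h1 := finite_case _ (fun p hp => hp.1) hf
  have h2 := (M_tendsto.sub_const 1).sub h1
  rw [zero_sub, sub_zero] at h2
  refine h2.congr' ?_
  filter_upwards [eventually_ge_atTop 1] with X hX
  have e : M X = 1 + ∑ n ∈ Finset.Icc 2 X, (moebius n : ℝ) / (n : ℝ) := by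
    unfold M
    rw [← Finset.insert_Icc_succ_left_eq_Icc hX, Finset.sum_insert (by simp)]
    simp
  rw [e, add_sub_cancel_left, ← Finset.sum_sub_distrib]
  refine Finset.sum_congr rfl fun n hn => ?_
  have hp := Nat.minFac_prime (n := n) (by have := (Finset.mem_Icc.1 hn).1; omega)
  by_cases h : n.minFac ∈ S <;> simp [h, hp]

end AlladiGen
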